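/- arXiv:1304.2141 — 3 statements merged into one kernel-verified Lean document; each statement's English description precedes it below -/
import Mathlib

section
/- Let a < b, let p : [a,b] → ℝ and q : [a,b] → ℝ be nonincreasing with p(x) ≤ a and q(x) ≥ b for all x ∈ [a,b], and let θ, α, δ, ψ, L be the associated Lagrangian data. Then L(x,y) ≥ 0 for all x, y ∈ ℝ, and moreover L(x,x) = 0, L(x,p(x)) = 0 and L(x,q(x)) = 0 for every x ∈ [a,b]. -/
open Set MeasureTheory intervalIntegral
open scoped Classical

noncomputable section

/-- θ(x) = ∫_{x₀}^x 2/(q z − p z) dz -/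
def thetaFn (p q : ℝ → ℝ) (x₀ x : ℝ) : ℝ := ∫ z in x₀..x, 2 / (q z - p z)

/-- α(x) = ∫_{x₀}^x (2x − q z − p z)/(q z − p z) dz -/
def alphaFn (p q : ℝ → ℝ) (x₀ x : ℝ) : ℝ :=
  ∫ z in x₀..x, (2 * x - q z - p z) / (q z - p z)

/-- right-continuous inverse of p : p_R⁻¹(y) = inf {x ∈ [a,b] : p x ≤ y}, = b if empty. -/
def pRinv (a b : ℝ) (p : ℝ → ℝ) (y : ℝ) : ℝ :=
  if ({x | x ∈ Icc a b ∧ p x ≤ y}).Nonempty then sInf {x | x ∈ Icc a b ∧ p x ≤ y} else b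

/-- left-continuous inverse of q : q_L⁻¹(y) = sup {x ∈ [a,b] : q x ≥ y}, = a if empty. -/
def qLinv (a b : ℝ) (q : ℝ → ℝ) (y : ℝ) : ℝ :=
  if ({x | x ∈ Icc a b ∧ y ≤ q x}).Nonempty then sSup {x | x ∈ Icc a b ∧ y ≤ q x} else a

def deltaFn (a b x₀ : ℝ) (p q : ℝ → ℝ) (x : ℝ) : ℝ :=
  if x < a then thetaFn p q x₀ (pRinv a b p x)
  else if x ≤ b then thetaFn p q x₀ x
  else thetaFn p q x₀ (qLinv a b q x)

def psiFn (a b x₀ : ℝ) (p q : ℝ → ℝ) (x : ℝ) : ℝ :=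
  if x < a then
    alphaFn p q x₀ (pRinv a b p x)
      + (pRinv a b p x - x) * (1 - thetaFn p q x₀ (pRinv a b p x))
  else if x ≤ b then alphaFn p q x₀ x
  else
    alphaFn p q x₀ (qLinv a b q x)
      + (qLinv a b q x - x) * (-1 - thetaFn p q x₀ (qLinv a b q x))

def LagFn (a b x₀ : ℝ) (p q : ℝ → ℝ) (x y : ℝ) : ℝ :=
  |y - x| + psiFn a b x₀ p q x - psiFn a b x₀ p q y + deltaFn a b x₀ p q x * (y - x)

/-- The affine function `y ↦ θ(c) y - ∫_{x₀}^c (q + p)/(q - p)`. -/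
def affFn (p q : ℝ → ℝ) (x₀ c y : ℝ) : ℝ :=
  ∫ z in x₀..c, (2 * y - q z - p z) / (q z - p z)

/-- The point of `[a, b]` at which `c ↦ affFn p q x₀ c y + |y - c|` is minimal. -/
def footFn (a b : ℝ) (p q : ℝ → ℝ) (y : ℝ) : ℝ :=
  if y < a then pRinv a b p y else if y ≤ b then y else qLinv a b q y

lemma integral_nonneg_of_Ioo {w : ℝ → ℝ} {c d : ℝ} (h : c ≤ d)
    (hw : ∀ z ∈ Ioo c d, 0 ≤ w z) : 0 ≤ ∫ z in c..d, w z := by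
  rw [integral_of_le h, integral_Ioc_eq_integral_Ioo]
  exact setIntegral_nonneg measurableSet_Ioo hw

lemma integral_nonneg_of_Ioo_nonpos {w : ℝ → ℝ} {c d : ℝ} (h : c ≤ d)
    (hw : ∀ z ∈ Ioo c d, w z ≤ 0) : 0 ≤ ∫ z in d..c, w z := by
  rw [integral_symm, integral_of_le h, integral_Ioc_eq_integral_Ioo]
  exact neg_nonneg.2 (setIntegral_nonpos measurableSet_Ioo hw)

lemma integral_eq_zero_of_Ioo {w : ℝ → ℝ} {c d : ℝ} (h : c ≤ d)
    (hw : ∀ z ∈ Ioo c d, w z = 0) : ∫ z in c..d, w z = 0 := by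
  rw [integral_of_le h, integral_Ioc_eq_integral_Ioo]
  exact setIntegral_eq_zero_of_forall_eq_zero hw

section

variable {a b : ℝ} {p q : ℝ → ℝ}

lemma sub_pos_of_bounds (hab : a < b) (hpa : ∀ x ∈ Icc a b, p x ≤ a)
    (hqb : ∀ x ∈ Icc a b, b ≤ q x) {z : ℝ} (hz : z ∈ Icc a b) : 0 < q z - p z := by
  linarith [hpa z hz, hqb z hz]

lemma intervalIntegrable_div_sub (hab : a < b) (hp : AntitoneOn p (Icc a b))
    (hq : AntitoneOn q (Icc a b)) (hpa : ∀ x ∈ Icc a b, p x ≤ a)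
    (hqb : ∀ x ∈ Icc a b, b ≤ q x) {c d : ℝ} (hc : c ∈ Icc a b) (hd : d ∈ Icc a b)
    {u : ℝ → ℝ} (hu : IntervalIntegrable u volume c d) :
    IntervalIntegrable (fun z => u z / (q z - p z)) volume c d := by
  have hsub : uIoc c d ⊆ Icc a b := uIoc_subset_uIcc.trans (uIcc_subset_Icc hc hd)
  rw [intervalIntegrable_iff] at hu ⊢
  have hmeas : AEMeasurable (fun z => (q z - p z)⁻¹) (volume.restrict (uIoc c d)) :=
    ((aemeasurable_restrict_of_antitoneOn measurableSet_uIoc (hq.mono hsub)).sub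
      (aemeasurable_restrict_of_antitoneOn measurableSet_uIoc (hp.mono hsub))).inv
  refine (Integrable.mul_bdd (c := (b - a)⁻¹) hu hmeas.aestronglyMeasurable ?_)
  refine (ae_restrict_iff' measurableSet_uIoc).2 (.of_forall fun z hz => ?_)
  have h1 := hpa z (hsub hz)
  have h2 := hqb z (hsub hz)
  rw [Real.norm_of_nonneg (inv_nonneg.2 (by linarith))]
  exact inv_anti₀ (by linarith) (by linarith)

lemma intervalIntegrable_affine_div_sub (hab : a < b) (hp : AntitoneOn p (Icc a b))
    (hq : AntitoneOn q (Icc a b)) (hpa : ∀ x ∈ Icc a b, p x ≤ a)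
    (hqb : ∀ x ∈ Icc a b, b ≤ q x) {c d : ℝ} (hc : c ∈ Icc a b) (hd : d ∈ Icc a b) (y : ℝ) :
    IntervalIntegrable (fun z => (2 * y - q z - p z) / (q z - p z)) volume c d := by
  have hsub : uIcc c d ⊆ Icc a b := uIcc_subset_Icc hc hd
  exact intervalIntegrable_div_sub hab hp hq hpa hqb hc hd
    ((intervalIntegrable_const.sub (hq.mono hsub).intervalIntegrable).sub
      (hp.mono hsub).intervalIntegrable)

lemma affFn_eq_alphaFn_add (hab : a < b) (hp : AntitoneOn p (Icc a b))
    (hq : AntitoneOn q (Icc a b)) (hpa : ∀ x ∈ Icc a b, p x ≤ a)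
    (hqb : ∀ x ∈ Icc a b, b ≤ q x) {x₀ c : ℝ} (hx₀ : x₀ ∈ Icc a b) (hc : c ∈ Icc a b) (y : ℝ) :
    affFn p q x₀ c y = alphaFn p q x₀ c + thetaFn p q x₀ c * (y - c) := by
  unfold affFn alphaFn thetaFn
  rw [← intervalIntegral.integral_mul_const, ← integral_add
    (intervalIntegrable_affine_div_sub hab hp hq hpa hqb hx₀ hc c)
    ((intervalIntegrable_div_sub hab hp hq hpa hqb hx₀ hc
      intervalIntegrable_const).mul_const _)]
  exact integral_congr fun z _ => by ring

lemma affFn_sub_affFn (hab : a < b) (hp : AntitoneOn p (Icc a b))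
    (hq : AntitoneOn q (Icc a b)) (hpa : ∀ x ∈ Icc a b, p x ≤ a)
    (hqb : ∀ x ∈ Icc a b, b ≤ q x) {x₀ c d : ℝ} (hx₀ : x₀ ∈ Icc a b) (hc : c ∈ Icc a b)
    (hd : d ∈ Icc a b) (y : ℝ) :
    affFn p q x₀ c y - affFn p q x₀ d y =
      ∫ z in d..c, (2 * y - q z - p z) / (q z - p z) :=
  integral_interval_sub_left (intervalIntegrable_affine_div_sub hab hp hq hpa hqb hx₀ hc y)
    (intervalIntegrable_affine_div_sub hab hp hq hpa hqb hx₀ hd y)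

lemma affFn_sub_affFn_add (hab : a < b) (hp : AntitoneOn p (Icc a b))
    (hq : AntitoneOn q (Icc a b)) (hpa : ∀ x ∈ Icc a b, p x ≤ a)
    (hqb : ∀ x ∈ Icc a b, b ≤ q x) {x₀ c d : ℝ} (hx₀ : x₀ ∈ Icc a b) (hc : c ∈ Icc a b)
    (hd : d ∈ Icc a b) (y : ℝ) :
    affFn p q x₀ c y - affFn p q x₀ d y + (c - d) =
      ∫ z in d..c, 2 * (y - p z) / (q z - p z) := by
  have h1 : c - d = ∫ _ in d..c, (1 : ℝ) := by simp
  rw [affFn_sub_affFn hab hp hq hpa hqb hx₀ hc hd, h1, ← integral_add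
    (intervalIntegrable_affine_div_sub hab hp hq hpa hqb hd hc y) intervalIntegrable_const]
  refine integral_congr fun z hz => ?_
  have := sub_pos_of_bounds hab hpa hqb (uIcc_subset_Icc hd hc hz)
  field_simp
  ring

lemma affFn_sub_affFn_sub (hab : a < b) (hp : AntitoneOn p (Icc a b))
    (hq : AntitoneOn q (Icc a b)) (hpa : ∀ x ∈ Icc a b, p x ≤ a)
    (hqb : ∀ x ∈ Icc a b, b ≤ q x) {x₀ c d : ℝ} (hx₀ : x₀ ∈ Icc a b) (hc : c ∈ Icc a b)
    (hd : d ∈ Icc a b) (y : ℝ) :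
    affFn p q x₀ c y - affFn p q x₀ d y - (c - d) =
      ∫ z in d..c, 2 * (y - q z) / (q z - p z) := by
  have h1 : c - d = ∫ _ in d..c, (1 : ℝ) := by simp
  rw [affFn_sub_affFn hab hp hq hpa hqb hx₀ hc hd, h1, ← integral_sub
    (intervalIntegrable_affine_div_sub hab hp hq hpa hqb hd hc y) intervalIntegrable_const]
  refine integral_congr fun z hz => ?_
  have := sub_pos_of_bounds hab hpa hqb (uIcc_subset_Icc hd hc hz)
  field_simp
  ring

lemma pRinv_mem (hab : a < b) (y : ℝ) : pRinv a b p y ∈ Icc a b := by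
  unfold pRinv
  split_ifs with h
  · have hbdd : BddBelow {x | x ∈ Icc a b ∧ p x ≤ y} := ⟨a, fun x hx => hx.1.1⟩
    obtain ⟨x, hx⟩ := h
    exact ⟨le_csInf ⟨x, hx⟩ fun x hx => hx.1.1, (csInf_le hbdd hx).trans hx.1.2⟩
  · exact right_mem_Icc.2 hab.le

lemma qLinv_mem (hab : a < b) (y : ℝ) : qLinv a b q y ∈ Icc a b := by
  unfold qLinv
  split_ifs with h
  · have hbdd : BddAbove {x | x ∈ Icc a b ∧ y ≤ q x} := ⟨b, fun x hx => hx.1.2⟩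
    obtain ⟨x, hx⟩ := h
    exact ⟨hx.1.1.trans (le_csSup hbdd hx), csSup_le ⟨x, hx⟩ fun x hx => hx.1.2⟩
  · exact left_mem_Icc.2 hab.le

lemma pRinv_le {x y : ℝ} (hx : x ∈ Icc a b) (hxy : p x ≤ y) : pRinv a b p y ≤ x := by
  have h : x ∈ {x | x ∈ Icc a b ∧ p x ≤ y} := ⟨hx, hxy⟩
  rw [pRinv, if_pos ⟨x, h⟩]
  exact csInf_le ⟨a, fun x hx => hx.1.1⟩ h

lemma le_qLinv {x y : ℝ} (hx : x ∈ Icc a b) (hxy : y ≤ q x) : x ≤ qLinv a b q y := by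
  have h : x ∈ {x | x ∈ Icc a b ∧ y ≤ q x} := ⟨hx, hxy⟩
  rw [qLinv, if_pos ⟨x, h⟩]
  exact le_csSup ⟨b, fun x hx => hx.1.2⟩ h

lemma le_of_pRinv_lt (hp : AntitoneOn p (Icc a b)) {y z : ℝ} (hz : z ∈ Icc a b)
    (h : pRinv a b p y < z) : p z ≤ y := by
  unfold pRinv at h
  split_ifs at h with hne
  · obtain ⟨x, hx, hxz⟩ := exists_lt_of_csInf_lt hne h
    exact (hp hx.1 hz hxz.le).trans hx.2
  · exact absurd hz.2 h.not_ge

lemma le_of_lt_qLinv (hq : AntitoneOn q (Icc a b)) {y z : ℝ} (hz : z ∈ Icc a b)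
    (h : z < qLinv a b q y) : y ≤ q z := by
  unfold qLinv at h
  split_ifs at h with hne
  · obtain ⟨x, hx, hxz⟩ := exists_lt_of_lt_csSup hne h
    exact hx.2.trans (hq hz hx.1 hxz.le)
  · exact absurd hz.1 h.not_ge

lemma footFn_mem (hab : a < b) (y : ℝ) : footFn a b p q y ∈ Icc a b := by
  unfold footFn
  split_ifs with h1 h2
  · exact pRinv_mem hab y
  · exact ⟨not_lt.1 h1, h2⟩
  · exact qLinv_mem hab y

lemma footFn_of_mem {y : ℝ} (hy : y ∈ Icc a b) : footFn a b p q y = y := by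
  rw [footFn, if_neg hy.1.not_gt, if_pos hy.2]

lemma footFn_of_lt {y : ℝ} (hy : y < a) : footFn a b p q y = pRinv a b p y :=
  if_pos hy

lemma footFn_of_gt (hab : a < b) {y : ℝ} (hy : b < y) : footFn a b p q y = qLinv a b q y := by
  rw [footFn, if_neg (hab.trans hy).not_gt, if_neg hy.not_ge]

lemma deltaFn_eq (x₀ y : ℝ) : deltaFn a b x₀ p q y = thetaFn p q x₀ (footFn a b p q y) := by
  unfold deltaFn footFn
  split_ifs <;> rfl

lemma psiFn_eq (hab : a < b) (hp : AntitoneOn p (Icc a b))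
    (hq : AntitoneOn q (Icc a b)) (hpa : ∀ x ∈ Icc a b, p x ≤ a)
    (hqb : ∀ x ∈ Icc a b, b ≤ q x) {x₀ : ℝ} (hx₀ : x₀ ∈ Icc a b) (y : ℝ) :
    psiFn a b x₀ p q y = affFn p q x₀ (footFn a b p q y) y + |y - footFn a b p q y| := by
  rw [affFn_eq_alphaFn_add hab hp hq hpa hqb hx₀ (footFn_mem hab y)]
  unfold psiFn
  rcases lt_or_ge y a with h1 | h1
  · rw [footFn_of_lt h1, if_pos h1,
      abs_of_nonpos (by linarith [(pRinv_mem (p := p) hab y).1])]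
    ring
  rcases le_or_gt y b with h2 | h2
  · simp [footFn_of_mem ⟨h1, h2⟩, h1.not_gt, h2]
  · rw [footFn_of_gt hab h2, if_neg h1.not_gt, if_neg h2.not_ge,
      abs_of_nonneg (by linarith [(qLinv_mem (q := q) hab y).2])]
    ring

lemma LagFn_eq (hab : a < b) (hp : AntitoneOn p (Icc a b))
    (hq : AntitoneOn q (Icc a b)) (hpa : ∀ x ∈ Icc a b, p x ≤ a)
    (hqb : ∀ x ∈ Icc a b, b ≤ q x) {x₀ : ℝ} (hx₀ : x₀ ∈ Icc a b) (x y : ℝ) :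
    LagFn a b x₀ p q x y = |y - x| + |x - footFn a b p q x|
      + affFn p q x₀ (footFn a b p q x) y
      - (affFn p q x₀ (footFn a b p q y) y + |y - footFn a b p q y|) := by
  rw [LagFn, psiFn_eq hab hp hq hpa hqb hx₀ x, psiFn_eq hab hp hq hpa hqb hx₀ y, deltaFn_eq,
    affFn_eq_alphaFn_add hab hp hq hpa hqb hx₀ (footFn_mem hab x) x,
    affFn_eq_alphaFn_add hab hp hq hpa hqb hx₀ (footFn_mem hab x) y]
  ring

lemma affFn_footFn_add_abs_le (hab : a < b) (hp : AntitoneOn p (Icc a b))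
    (hq : AntitoneOn q (Icc a b)) (hpa : ∀ x ∈ Icc a b, p x ≤ a)
    (hqb : ∀ x ∈ Icc a b, b ≤ q x) {x₀ c : ℝ} (hx₀ : x₀ ∈ Icc a b) (hc : c ∈ Icc a b) (y : ℝ) :
    affFn p q x₀ (footFn a b p q y) y + |y - footFn a b p q y| ≤
      affFn p q x₀ c y + |y - c| := by
  have hd : footFn a b p q y ∈ Icc a b := footFn_mem hab y
  have hadd := affFn_sub_affFn_add hab hp hq hpa hqb hx₀ hc hd y
  have hsub := affFn_sub_affFn_sub hab hp hq hpa hqb hx₀ hc hd y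
  have hpos : ∀ {z}, z ∈ Icc a b → 0 < q z - p z := sub_pos_of_bounds hab hpa hqb
  rcases lt_or_ge y a with h1 | h1
  · rw [abs_of_nonpos (by linarith [hd.1]), abs_of_nonpos (by linarith [hc.1])]
    suffices 0 ≤ ∫ z in footFn a b p q y..c, 2 * (y - p z) / (q z - p z) by linarith
    rw [footFn_of_lt h1] at hd ⊢
    rcases le_total (pRinv a b p y) c with h | h
    · refine integral_nonneg_of_Ioo h fun z hz => ?_
      have hz' : z ∈ Icc a b := ⟨hd.1.trans hz.1.le, hz.2.le.trans hc.2⟩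
      exact div_nonneg (by linarith [le_of_pRinv_lt hp hz' hz.1]) (hpos hz').le
    · refine integral_nonneg_of_Ioo_nonpos h fun z hz => ?_
      have hz' : z ∈ Icc a b := ⟨hc.1.trans hz.1.le, hz.2.le.trans hd.2⟩
      have : y ≤ p z := le_of_not_ge fun h' => hz.2.not_ge (pRinv_le hz' h')
      exact div_nonpos_of_nonpos_of_nonneg (by linarith) (hpos hz').le
  rcases le_or_gt y b with h2 | h2
  · rw [footFn_of_mem ⟨h1, h2⟩] at *
    rcases le_total y c with h | h
    · rw [sub_self, abs_zero, abs_of_nonpos (by linarith)]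
      suffices 0 ≤ ∫ z in y..c, 2 * (y - p z) / (q z - p z) by linarith
      refine integral_nonneg_of_Ioo h fun z hz => ?_
      have hz' : z ∈ Icc a b := ⟨hd.1.trans hz.1.le, hz.2.le.trans hc.2⟩
      exact div_nonneg (by linarith [hpa z hz']) (hpos hz').le
    · rw [sub_self, abs_zero, abs_of_nonneg (by linarith)]
      suffices 0 ≤ ∫ z in y..c, 2 * (y - q z) / (q z - p z) by linarith
      refine integral_nonneg_of_Ioo_nonpos h fun z hz => ?_
      have hz' : z ∈ Icc a b := ⟨hc.1.trans hz.1.le, hz.2.le.trans hd.2⟩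
      exact div_nonpos_of_nonpos_of_nonneg (by linarith [hqb z hz']) (hpos hz').le
  · rw [abs_of_nonneg (by linarith [hd.2]), abs_of_nonneg (by linarith [hc.2])]
    suffices 0 ≤ ∫ z in footFn a b p q y..c, 2 * (y - q z) / (q z - p z) by linarith
    rw [footFn_of_gt hab h2] at hd ⊢
    rcases le_total (qLinv a b q y) c with h | h
    · refine integral_nonneg_of_Ioo h fun z hz => ?_
      have hz' : z ∈ Icc a b := ⟨hd.1.trans hz.1.le, hz.2.le.trans hc.2⟩
      have : q z ≤ y := le_of_not_ge fun h' => hz.1.not_ge (le_qLinv hz' h')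
      exact div_nonneg (by linarith) (hpos hz').le
    · refine integral_nonneg_of_Ioo_nonpos h fun z hz => ?_
      have hz' : z ∈ Icc a b := ⟨hc.1.trans hz.1.le, hz.2.le.trans hd.2⟩
      exact div_nonpos_of_nonpos_of_nonneg
        (by linarith [le_of_lt_qLinv hq hz' hz.2]) (hpos hz').le

lemma affFn_footFn_left (hab : a < b) (hp : AntitoneOn p (Icc a b))
    (hq : AntitoneOn q (Icc a b)) (hpa : ∀ x ∈ Icc a b, p x ≤ a)
    (hqb : ∀ x ∈ Icc a b, b ≤ q x) {x₀ x : ℝ} (hx₀ : x₀ ∈ Icc a b) (hx : x ∈ Icc a b) :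
    affFn p q x₀ (footFn a b p q (p x)) (p x) + |p x - footFn a b p q (p x)| =
      affFn p q x₀ x (p x) + |p x - x| := by
  have hd : footFn a b p q (p x) ∈ Icc a b := footFn_mem hab _
  have hadd := affFn_sub_affFn_add hab hp hq hpa hqb hx₀ hx hd (p x)
  have hspec : footFn a b p q (p x) ≤ x ∧
      ∀ z ∈ Ioo (footFn a b p q (p x)) x, p z ≤ p x := by
    rcases (hpa x hx).lt_or_eq with h | h
    · rw [footFn_of_lt h] at hd ⊢
      exact ⟨pRinv_le hx le_rfl, fun z hz =>
        le_of_pRinv_lt hp ⟨hd.1.trans hz.1.le, hz.2.le.trans hx.2⟩ hz.1⟩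
    · rw [footFn_of_mem ⟨h.ge, h.le.trans hab.le⟩, h]
      exact ⟨hx.1, fun z hz => hpa z ⟨hz.1.le, hz.2.le.trans hx.2⟩⟩
  rw [integral_eq_zero_of_Ioo hspec.1 fun z hz => ?_] at hadd
  · rw [abs_of_nonpos (by linarith [hd.1, hpa x hx]),
      abs_of_nonpos (by linarith [hx.1, hpa x hx])]
    linarith
  · rw [le_antisymm (hspec.2 z hz) (hp ⟨hd.1.trans hz.1.le, hz.2.le.trans hx.2⟩ hx hz.2.le)]
    simp

lemma affFn_footFn_right (hab : a < b) (hp : AntitoneOn p (Icc a b))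
    (hq : AntitoneOn q (Icc a b)) (hpa : ∀ x ∈ Icc a b, p x ≤ a)
    (hqb : ∀ x ∈ Icc a b, b ≤ q x) {x₀ x : ℝ} (hx₀ : x₀ ∈ Icc a b) (hx : x ∈ Icc a b) :
    affFn p q x₀ (footFn a b p q (q x)) (q x) + |q x - footFn a b p q (q x)| =
      affFn p q x₀ x (q x) + |q x - x| := by
  have hd : footFn a b p q (q x) ∈ Icc a b := footFn_mem hab _
  have hsub := affFn_sub_affFn_sub hab hp hq hpa hqb hx₀ hd hx (q x)
  have hspec : x ≤ footFn a b p q (q x) ∧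
      ∀ z ∈ Ioo x (footFn a b p q (q x)), q x ≤ q z := by
    rcases (hqb x hx).lt_or_eq with h | h
    · rw [footFn_of_gt hab h] at hd ⊢
      exact ⟨le_qLinv hx le_rfl, fun z hz =>
        le_of_lt_qLinv hq ⟨hx.1.trans hz.1.le, hz.2.le.trans hd.2⟩ hz.2⟩
    · rw [footFn_of_mem ⟨hab.le.trans h.le, h.ge⟩, ← h]
      exact ⟨hx.2, fun z hz => hqb z ⟨hx.1.trans hz.1.le, hz.2.le⟩⟩
  rw [integral_eq_zero_of_Ioo hspec.1 fun z hz => ?_] at hsub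
  · rw [abs_of_nonneg (by linarith [hd.2, hqb x hx]),
      abs_of_nonneg (by linarith [hx.2, hqb x hx])]
    linarith
  · rw [le_antisymm (hspec.2 z hz) (hq hx ⟨hx.1.trans hz.1.le, hz.2.le.trans hd.2⟩ hz.1.le)]
    simp

end

theorem stmt0 (a b x₀ : ℝ) (hab : a < b) (hx₀ : x₀ ∈ Icc a b)
    (p q : ℝ → ℝ)
    (hp : AntitoneOn p (Icc a b)) (hq : AntitoneOn q (Icc a b))
    (hpa : ∀ x ∈ Icc a b, p x ≤ a) (hqb : ∀ x ∈ Icc a b, b ≤ q x) :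
    (∀ x y : ℝ, 0 ≤ LagFn a b x₀ p q x y) ∧
    (∀ x ∈ Icc a b,
      LagFn a b x₀ p q x x = 0 ∧
      LagFn a b x₀ p q x (p x) = 0 ∧
      LagFn a b x₀ p q x (q x) = 0) := by
  refine ⟨fun x y => ?_, fun x hx => ⟨by simp [LagFn], ?_, ?_⟩⟩
  · rw [LagFn_eq hab hp hq hpa hqb hx₀]
    have h1 := affFn_footFn_add_abs_le hab hp hq hpa hqb hx₀
      (footFn_mem (p := p) (q := q) hab x) y
    have h2 := abs_sub_le y x (footFn a b p q x)
    linarith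
  · rw [LagFn_eq hab hp hq hpa hqb hx₀, footFn_of_mem hx,
      affFn_footFn_left hab hp hq hpa hqb hx₀ hx, sub_self, abs_zero]
    ring
  · rw [LagFn_eq hab hp hq hpa hqb hx₀, footFn_of_mem hx,
      affFn_footFn_right hab hp hq hpa hqb hx₀ hx, sub_self, abs_zero]
    ring
end
end

section
/- Let a < b, let p : [a,b] → ℝ and q : [a,b] → ℝ be nonincreasing with p(x) ≤ a and q(x) ≥ b for all x ∈ [a,b], and let θ, α be the associated multipliers. If z₁ ≤ z₂ in [a,b] and x̂ > b satisfies q(z) = x̂ for all z ∈ [z₁,z₂], then α(z₂) + (z₂ − x̂)(−1 − θ(z₂)) = α(z₁) + (z₁ − x̂)(−1 − θ(z₁)). Similarly, if z₁ ≤ z₂ in [a,b] and x̂ < a satisfies p(z) = x̂ for all z ∈ [z₁,z₂], then α(z₂) + (z₂ − x̂)(1 − θ(z₂)) = α(z₁) + (z₁ − x̂)(1 − θ(z₁)). Consequently the extended function ψ(x) for x > b (respectively x < a) does not depend on the choice of element of q⁻¹(x) (respectively p⁻¹(x)). -/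
open Set MeasureTheory intervalIntegral
open scoped Classical

noncomputable section

theorem intervalIntegrable_two_div_sub {a b u v : ℝ} {p q : ℝ → ℝ} (hab : a < b)
    (hp : AntitoneOn p (Icc a b)) (hq : AntitoneOn q (Icc a b))
    (hpa : ∀ x ∈ Icc a b, p x ≤ a) (hqb : ∀ x ∈ Icc a b, b ≤ q x)
    (hu : u ∈ Icc a b) (hv : v ∈ Icc a b) :
    IntervalIntegrable (fun z => 2 / (q z - p z)) volume u v := by
  have hm : AEMeasurable (fun z => 2 / (q z - p z)) (volume.restrict (Icc a b)) :=
    ((aemeasurable_restrict_of_antitoneOn measurableSet_Icc hq).sub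
      (aemeasurable_restrict_of_antitoneOn measurableSet_Icc hp)).const_div 2
  have hI : IntegrableOn (fun z => 2 / (q z - p z)) (Icc a b) := by
    refine Integrable.of_bound hm.aestronglyMeasurable (2 / (b - a)) ?_
    filter_upwards [ae_restrict_mem measurableSet_Icc] with z hz
    have hgap : b - a ≤ q z - p z := by linarith [hpa z hz, hqb z hz]
    have hpos : 0 < b - a := sub_pos.2 hab
    rw [Real.norm_of_nonneg (div_nonneg zero_le_two (hpos.le.trans hgap))]
    exact div_le_div_of_nonneg_left zero_le_two hpos hgap
  exact (hI.mono_set (uIcc_subset_Icc hu hv)).intervalIntegrable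

theorem intervalIntegrable_multiplier {a b u v : ℝ} {p q : ℝ → ℝ} (hab : a < b)
    (hp : AntitoneOn p (Icc a b)) (hq : AntitoneOn q (Icc a b))
    (hpa : ∀ x ∈ Icc a b, p x ≤ a) (hqb : ∀ x ∈ Icc a b, b ≤ q x)
    (hu : u ∈ Icc a b) (hv : v ∈ Icc a b) (c : ℝ) :
    IntervalIntegrable (fun z => (2 * c - q z - p z) / (q z - p z)) volume u v := by
  have hsub := uIcc_subset_Icc hu hv
  have hs := intervalIntegrable_two_div_sub hab hp hq hpa hqb hu hv
  -- the integrand equals `2 * (c - p z) / (q z - p z) - 1`, where `c - p` is monotone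
  have hm : MonotoneOn (fun z => c - p z) (uIcc u v) :=
    fun x hx y hy hxy => sub_le_sub_left (hp (hsub hx) (hsub hy) hxy) c
  have hbdd : ∀ z ∈ uIcc u v, ‖c - p z‖ ≤ max |c - p a| |c - p b| := by
    intro z hz
    have hz' := hsub hz
    exact abs_le_max_abs_abs
      (sub_le_sub_left (hp (left_mem_Icc.2 hab.le) hz' hz'.1) c)
      (sub_le_sub_left (hp hz' (right_mem_Icc.2 hab.le) hz'.2) c)
  have hprod : IntervalIntegrable (fun z => (c - p z) * (2 / (q z - p z))) volume u v := by
    rw [intervalIntegrable_iff] at hs ⊢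
    refine hs.bdd_mul (c := max |c - p a| |c - p b|)
      (aemeasurable_restrict_of_monotoneOn measurableSet_uIoc
        (hm.mono uIoc_subset_uIcc)).aestronglyMeasurable ?_
    filter_upwards [ae_restrict_mem measurableSet_uIoc] with z hz
    exact hbdd z (uIoc_subset_uIcc hz)
  refine (hprod.sub (_root_.intervalIntegrable_const (c := (1 : ℝ)))).congr ?_
  intro z hz
  have hz' := hsub (uIoc_subset_uIcc hz)
  have hne : q z - p z ≠ 0 := ne_of_gt (by linarith [hpa z hz', hqb z hz'])
  simp only
  field_simp
  ring

theorem alphaFn_add_mul_thetaFn {a b x₀ x : ℝ} {p q : ℝ → ℝ} (hab : a < b)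
    (hp : AntitoneOn p (Icc a b)) (hq : AntitoneOn q (Icc a b))
    (hpa : ∀ x ∈ Icc a b, p x ≤ a) (hqb : ∀ x ∈ Icc a b, b ≤ q x)
    (hx₀ : x₀ ∈ Icc a b) (hx : x ∈ Icc a b) (c : ℝ) :
    alphaFn p q x₀ x + (c - x) * thetaFn p q x₀ x
      = ∫ z in x₀..x, (2 * c - q z - p z) / (q z - p z) := by
  rw [alphaFn, thetaFn, ← intervalIntegral.integral_const_mul, ← intervalIntegral.integral_add
    (intervalIntegrable_multiplier hab hp hq hpa hqb hx₀ hx x)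
    ((intervalIntegrable_two_div_sub hab hp hq hpa hqb hx₀ hx).const_mul _)]
  congr 1
  ext z
  ring

theorem alphaFn_add_mul_eq_of_multiplier_const {a b x₀ z₁ z₂ c ε : ℝ} {p q : ℝ → ℝ}
    (hab : a < b) (hp : AntitoneOn p (Icc a b)) (hq : AntitoneOn q (Icc a b))
    (hpa : ∀ x ∈ Icc a b, p x ≤ a) (hqb : ∀ x ∈ Icc a b, b ≤ q x)
    (hx₀ : x₀ ∈ Icc a b) (hz₁ : z₁ ∈ Icc a b) (hz₂ : z₂ ∈ Icc a b) (hz : z₁ ≤ z₂)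
    (hc : ∀ z ∈ Icc z₁ z₂, (2 * c - q z - p z) / (q z - p z) = ε) :
    alphaFn p q x₀ z₂ + (z₂ - c) * (-ε - thetaFn p q x₀ z₂)
      = alphaFn p q x₀ z₁ + (z₁ - c) * (-ε - thetaFn p q x₀ z₁) := by
  have hdiff := intervalIntegral.integral_interval_sub_left
    (intervalIntegrable_multiplier hab hp hq hpa hqb hx₀ hz₂ c)
    (intervalIntegrable_multiplier hab hp hq hpa hqb hx₀ hz₁ c)
  have hconst : ∫ z in z₁..z₂, (2 * c - q z - p z) / (q z - p z) = (z₂ - z₁) * ε := by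
    rw [intervalIntegral.integral_congr (g := fun _ => ε)
      (fun z h => hc z (by rwa [uIcc_of_le hz] at h))]
    simp
  rw [hconst, ← alphaFn_add_mul_thetaFn hab hp hq hpa hqb hx₀ hz₂,
    ← alphaFn_add_mul_thetaFn hab hp hq hpa hqb hx₀ hz₁] at hdiff
  linarith

theorem stmt1 (a b x₀ : ℝ) (hab : a < b) (hx₀ : x₀ ∈ Icc a b)
    (p q : ℝ → ℝ)
    (hp : AntitoneOn p (Icc a b)) (hq : AntitoneOn q (Icc a b))
    (hpa : ∀ x ∈ Icc a b, p x ≤ a) (hqb : ∀ x ∈ Icc a b, b ≤ q x) :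
    (∀ z₁ z₂ xh : ℝ, z₁ ∈ Icc a b → z₂ ∈ Icc a b → z₁ ≤ z₂ → b < xh →
      (∀ z ∈ Icc z₁ z₂, q z = xh) →
      alphaFn p q x₀ z₂ + (z₂ - xh) * (-1 - thetaFn p q x₀ z₂)
        = alphaFn p q x₀ z₁ + (z₁ - xh) * (-1 - thetaFn p q x₀ z₁)) ∧
    (∀ z₁ z₂ xh : ℝ, z₁ ∈ Icc a b → z₂ ∈ Icc a b → z₁ ≤ z₂ → xh < a →
      (∀ z ∈ Icc z₁ z₂, p z = xh) →
      alphaFn p q x₀ z₂ + (z₂ - xh) * (1 - thetaFn p q x₀ z₂)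
        = alphaFn p q x₀ z₁ + (z₁ - xh) * (1 - thetaFn p q x₀ z₁)) := by
  have hne : ∀ z ∈ Icc a b, q z - p z ≠ 0 := fun z hz =>
    ne_of_gt (by linarith [hpa z hz, hqb z hz])
  constructor
  · intro z₁ z₂ xh hz₁ hz₂ hz _ hqz
    refine alphaFn_add_mul_eq_of_multiplier_const hab hp hq hpa hqb hx₀ hz₁ hz₂ hz
      fun z h => ?_
    rw [div_eq_one_iff_eq (hne z (Icc_subset_Icc hz₁.1 hz₂.2 h)), ← hqz z h]
    ring
  · intro z₁ z₂ xh hz₁ hz₂ hz _ hpz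
    have hmain := alphaFn_add_mul_eq_of_multiplier_const (c := xh) (ε := -1)
      hab hp hq hpa hqb hx₀ hz₁ hz₂ hz fun z h => by
        rw [div_eq_iff (hne z (Icc_subset_Icc hz₁.1 hz₂.2 h)), ← hpz z h]
        ring
    rwa [neg_neg] at hmain
end
end

section
/- Under the disjoint-support setup, assume that for every u ∈ (0,1) the supremum defining φ(u) is attained at P(u) ≤ a and Q(u) ≥ b with P(u) < F_η⁻¹(u) < Q(u), and that P and Q are nonincreasing. Then for Lebesgue-almost every u ∈ (0,1), φ is differentiable at u with φ′(u) = −(Q(u) − F_η⁻¹(u))/(Q(u) − P(u)). -/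
open Set MeasureTheory ProbabilityTheory
open scoped ENNReal Classical

noncomputable section

/-- C_ζ(x) = ∫ (y − x)⁺ ζ(dy). -/
def Cfun (ζ : Measure ℝ) (x : ℝ) : ℝ := ∫ y, max (y - x) 0 ∂ζ

/-- D(x) = C_γ(x) − C_η(x). -/
def Dfun (η γ : Measure ℝ) (x : ℝ) : ℝ := Cfun γ x - Cfun η x

/-- Left-continuous quantile function F_η⁻¹(u) = inf {x : F_η(x) ≥ u}. -/
def Finv (η : Measure ℝ) (u : ℝ) : ℝ := sInf {x : ℝ | u ≤ (η (Iic x)).toReal}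

/-- ℰ_u(x) = D(F_η⁻¹(u)) + (x − F_η⁻¹(u))(γ_a − u) − D(x), where γ_a = γ((−∞,a]). -/
def Efun (η γ : Measure ℝ) (a u x : ℝ) : ℝ :=
  Dfun η γ (Finv η u) + (x - Finv η u) * ((γ (Iic a)).toReal - u) - Dfun η γ x

/-- φ(u) = sup over p̂ ≤ a, q̂ ≥ b with p̂ < F_η⁻¹(u) < q̂ of (ℰ_u(q̂) − D(p̂))/(q̂ − p̂). -/
def phiFn (η γ : Measure ℝ) (a b u : ℝ) : ℝ :=
  sSup {r : ℝ | ∃ pp qq : ℝ, pp ≤ a ∧ b ≤ qq ∧ pp < Finv η u ∧ Finv η u < qq ∧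
    r = (Efun η γ a u qq - Dfun η γ pp) / (qq - pp)}

/-- ζ(u) = γ_a − u − φ(u). -/
def zetaFn (η γ : Measure ℝ) (a b u : ℝ) : ℝ :=
  (γ (Iic a)).toReal - u - phiFn η γ a b u

/-- The attainment hypothesis: for u ∈ (0,1) the supremum defining φ(u) is attained at
P(u) ≤ a and Q(u) ≥ b with P(u) < F_η⁻¹(u) < Q(u). -/
def AttainsSup (η γ : Measure ℝ) (a b : ℝ) (P Q : ℝ → ℝ) : Prop :=
  ∀ u ∈ Ioo (0 : ℝ) 1,
    P u ≤ a ∧ b ≤ Q u ∧ P u < Finv η u ∧ Finv η u < Q u ∧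
    phiFn η γ a b u = (Efun η γ a u (Q u) - Dfun η γ (P u)) / (Q u - P u)

/-- A function squeezed between the linear increments of slopes `c u` and `c v`, with `c`
continuous at `u`, has derivative `c u` at `u`. -/
lemma hasDerivAt_of_increment_bounds {f c : ℝ → ℝ} {u : ℝ} (hc : ContinuousAt c u)
    (hlow : ∀ᶠ v in nhds u, (v - u) * c u ≤ f v - f u)
    (hupp : ∀ᶠ v in nhds u, f v - f u ≤ (v - u) * c v) :
    HasDerivAt f (c u) u := by
  rw [hasDerivAt_iff_isLittleO, Asymptotics.isLittleO_iff]
  intro ε hε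
  filter_upwards [hlow, hupp, Metric.continuousAt_iff'.1 hc ε hε] with v h1 h2 h3
  rw [Real.dist_eq] at h3
  simp only [smul_eq_mul, Real.norm_eq_abs]
  rw [abs_of_nonneg (by linarith)]
  calc f v - f u - (v - u) * c u ≤ (v - u) * (c v - c u) := by linarith
    _ ≤ |(v - u) * (c v - c u)| := le_abs_self _
    _ = |c v - c u| * |v - u| := by rw [abs_mul, mul_comm]
    _ ≤ ε * |v - u| := by gcongr

lemma integrable_call {ζ : Measure ℝ} [IsProbabilityMeasure ζ] (h : Integrable id ζ) (x : ℝ) :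
    Integrable (fun y => max (y - x) 0) ζ :=
  (h.sub (integrable_const x)).pos_part

section Quantile

variable {a b : ℝ} {η : Measure ℝ} {u : ℝ}

lemma lowerBound_quantile_set (hη : η (Icc a b)ᶜ = 0) (hu : 0 < u) :
    a ∈ lowerBounds {x : ℝ | u ≤ (η (Iic x)).toReal} := by
  intro x hx
  by_contra! hxa
  have h0 : η (Iic x) = 0 := measure_mono_null
    (fun y (hy : y ≤ x) => fun hy' => absurd hy'.1 (by linarith)) hη
  simp only [mem_ofPred_eq, h0, ENNReal.toReal_zero] at hx
  linarith

variable [IsProbabilityMeasure η]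

lemma right_mem_quantile_set (hη : η (Icc a b)ᶜ = 0) (hu : u < 1) :
    b ∈ {x : ℝ | u ≤ (η (Iic x)).toReal} := by
  have h0 : η (Iic b) = 1 := by
    rw [prob_compl_eq_zero_iff measurableSet_Icc] at hη
    exact le_antisymm prob_le_one (hη ▸ measure_mono Icc_subset_Iic_self)
  simp only [mem_ofPred_eq, h0, ENNReal.toReal_one]
  exact hu.le

lemma Finv_mem_Icc (hη : η (Icc a b)ᶜ = 0) (hu : u ∈ Ioo (0 : ℝ) 1) :
    Finv η u ∈ Icc a b :=
  ⟨le_csInf ⟨b, right_mem_quantile_set hη hu.2⟩ (lowerBound_quantile_set hη hu.1),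
    csInf_le ⟨a, lowerBound_quantile_set hη hu.1⟩ (right_mem_quantile_set hη hu.2)⟩

lemma Finv_monotoneOn (hη : η (Icc a b)ᶜ = 0) : MonotoneOn (Finv η) (Ioo 0 1) := by
  intro u hu v hv huv
  exact csInf_le_csInf ⟨a, lowerBound_quantile_set hη hu.1⟩ ⟨b, right_mem_quantile_set hη hv.2⟩
    fun x hx => huv.trans hx

lemma le_measureReal_Iic_Finv (hη : η (Icc a b)ᶜ = 0) (hu : u ∈ Ioo (0 : ℝ) 1) :
    u ≤ η.real (Iic (Finv η u)) := by
  have hc := (cdf η).right_continuous (Finv η u)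
  rw [← cdf_eq_real]
  refine ge_of_tendsto (hc.mono_left (nhdsWithin_mono _ Ioi_subset_Ici_self)) ?_
  filter_upwards [self_mem_nhdsWithin] with x hx
  obtain ⟨y, hy, hyx⟩ := exists_lt_of_csInf_lt ⟨b, right_mem_quantile_set hη hu.2⟩ hx
  refine le_trans ?_ ((cdf η).mono hyx.le)
  rw [cdf_eq_real]
  exact hy

lemma measureReal_Iio_Finv_le (hη : η (Icc a b)ᶜ = 0) (hu : u ∈ Ioo (0 : ℝ) 1) :
    η.real (Iio (Finv η u)) ≤ u := by
  have h : η (Iio (Finv η u)) = ENNReal.ofReal (Function.leftLim (cdf η) (Finv η u)) := by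
    have := (cdf η).measure_Iio (tendsto_cdf_atBot η) (Finv η u)
    rwa [measure_cdf, sub_zero] at this
  rw [measureReal_def, h]
  refine ENNReal.toReal_le_of_le_ofReal hu.1.le (ENNReal.ofReal_le_ofReal ?_)
  refine le_of_tendsto ((cdf η).mono.tendsto_leftLim (Finv η u)) ?_
  filter_upwards [self_mem_nhdsWithin] with x hx
  rw [cdf_eq_real]
  have := notMem_of_lt_csInf hx ⟨a, lowerBound_quantile_set hη hu.1⟩
  simp only [mem_ofPred_eq, not_le] at this
  exact this.le

/-- The quantile `F_η⁻¹(u)` minimises `x ↦ C_η(x) + (1 - u) x`. -/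
lemma Cfun_Finv_add_le (hη : η (Icc a b)ᶜ = 0) (hη1 : Integrable id η)
    (hu : u ∈ Ioo (0 : ℝ) 1) (x : ℝ) :
    Cfun η (Finv η u) + (1 - u) * Finv η u ≤ Cfun η x + (1 - u) * x := by
  have hle := le_measureReal_Iic_Finv hη hu
  have hge := measureReal_Iio_Finv_le hη hu
  set t := Finv η u
  rcases le_total t x with htx | hxt
  · have hI : Integrable ((Ioi t).indicator fun _ : ℝ => x - t) η :=
      (integrable_const _).indicator measurableSet_Ioi
    have key : Cfun η t ≤ Cfun η x + ∫ y, (Ioi t).indicator (fun _ => x - t) y ∂η := by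
      unfold Cfun
      rw [← integral_add (integrable_call hη1 x) hI]
      refine integral_mono (integrable_call hη1 t) ((integrable_call hη1 x).add hI) fun y => ?_
      simp only [indicator, mem_Ioi]
      split_ifs with h <;> grind
    rw [integral_indicator_const _ measurableSet_Ioi, ← compl_Iic,
      probReal_compl_eq_one_sub measurableSet_Iic, smul_eq_mul] at key
    nlinarith
  · have hI : Integrable ((Ici t).indicator fun _ : ℝ => t - x) η :=
      (integrable_const _).indicator measurableSet_Ici
    have key : Cfun η t + ∫ y, (Ici t).indicator (fun _ => t - x) y ∂η ≤ Cfun η x := by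
      unfold Cfun
      rw [← integral_add (integrable_call hη1 t) hI]
      refine integral_mono ((integrable_call hη1 t).add hI) (integrable_call hη1 x) fun y => ?_
      simp only [indicator, mem_Ici]
      split_ifs with h <;> grind
    rw [integral_indicator_const _ measurableSet_Ici, ← compl_Iio,
      probReal_compl_eq_one_sub measurableSet_Iio, smul_eq_mul] at key
    nlinarith

end Quantile

lemma Cfun_eq_affine {a b : ℝ} {γ : Measure ℝ} [IsProbabilityMeasure γ]
    (hγ1 : Integrable id γ) (hγ : γ (Ioo a b) = 0) {x : ℝ} (hx : x ∈ Icc a b) :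
    Cfun γ x = (∫ y in Ioi a, y ∂γ) - x * (1 - γ.real (Iic a)) := by
  have hae : ∀ᵐ y ∂γ, y ∉ Ioo a b := measure_eq_zero_iff_ae_notMem.1 hγ
  have h : Cfun γ x = ∫ y in Ioi a, (y - x) ∂γ := by
    rw [← integral_indicator measurableSet_Ioi]
    refine integral_congr_ae ?_
    filter_upwards [hae] with y hy
    obtain ⟨h1, h2⟩ := hx
    simp only [mem_Ioo, not_and, not_lt] at hy
    simp only [indicator, mem_Ioi]
    split_ifs with h <;> grind
  have hγ1' : Integrable (fun y : ℝ => y) γ := hγ1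
  rw [h, integral_sub hγ1'.integrableOn (integrable_const x), setIntegral_const, ← compl_Iic,
    probReal_compl_eq_one_sub measurableSet_Iic, smul_eq_mul, mul_comm x]

/-- Raising the level from `u` to `v` raises `D(F_η⁻¹) - F_η⁻¹ (γ_a - ·)` at least by
`F_η⁻¹(u) (v - u)`. -/
lemma Dfun_Finv_increment {a b : ℝ} {η γ : Measure ℝ}
    [IsProbabilityMeasure η] [IsProbabilityMeasure γ]
    (hη1 : Integrable id η) (hγ1 : Integrable id γ)
    (hη : η (Icc a b)ᶜ = 0) (hγ : γ (Ioo a b) = 0) {u v : ℝ}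
    (hu : u ∈ Ioo (0 : ℝ) 1) (hv : v ∈ Ioo (0 : ℝ) 1) :
    Dfun η γ (Finv η u) - Finv η u * (γ.real (Iic a) - u) + Finv η u * (v - u) ≤
      Dfun η γ (Finv η v) - Finv η v * (γ.real (Iic a) - v) := by
  have h := Cfun_Finv_add_le hη hη1 hv (Finv η u)
  unfold Dfun
  rw [Cfun_eq_affine hγ1 hγ (Finv_mem_Icc hη hu), Cfun_eq_affine hγ1 hγ (Finv_mem_Icc hη hv)]
  linarith

lemma le_phiFn {a b : ℝ} (hab : a < b) {η γ : Measure ℝ}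
    (hC : ∀ x : ℝ, Cfun η x ≤ Cfun γ x) {u p q : ℝ} (hp : p ≤ a) (hq : b ≤ q)
    (hpF : p < Finv η u) (hFq : Finv η u < q) :
    (Efun η γ a u q - Dfun η γ p) / (q - p) ≤ phiFn η γ a b u := by
  have hD : ∀ x, 0 ≤ Dfun η γ x := fun x => sub_nonneg.2 (hC x)
  refine le_csSup ⟨Dfun η γ (Finv η u) / (b - a) + |(γ (Iic a)).toReal - u|, ?_⟩
    ⟨p, q, hp, hq, hpF, hFq, rfl⟩
  rintro r ⟨p, q, hp, hq, hpF, hFq, rfl⟩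
  have hba : 0 < b - a := by linarith
  have h1 : Dfun η γ (Finv η u) ≤ Dfun η γ (Finv η u) / (b - a) * (q - p) := by
    rw [div_mul_eq_mul_div, le_div_iff₀ hba]
    exact mul_le_mul_of_nonneg_left (by linarith) (hD _)
  have h2 : (q - Finv η u) * ((γ (Iic a)).toReal - u) ≤
      |(γ (Iic a)).toReal - u| * (q - p) := by
    rw [mul_comm]
    exact (mul_le_mul_of_nonneg_right (le_abs_self _) (by linarith)).trans
      (mul_le_mul_of_nonneg_left (by linarith) (abs_nonneg _))
  rw [div_le_iff₀ (by linarith), add_mul]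
  unfold Efun
  linarith [hD p, hD q]

/-- For a pair `(p, q)` attaining the supremum at level `u` and admissible at level `v`, the
increment of `φ` from `u` to `v` is bounded below linearly. -/
lemma phiFn_increment {a b : ℝ} (hab : a < b) {η γ : Measure ℝ}
    [IsProbabilityMeasure η] [IsProbabilityMeasure γ]
    (hη1 : Integrable id η) (hγ1 : Integrable id γ)
    (hη : η (Icc a b)ᶜ = 0) (hγ : γ (Ioo a b) = 0)
    (hC : ∀ x : ℝ, Cfun η x ≤ Cfun γ x) {P Q : ℝ → ℝ} (hPQ : AttainsSup η γ a b P Q) {u v : ℝ}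
    (hu : u ∈ Ioo (0 : ℝ) 1) (hv : v ∈ Ioo (0 : ℝ) 1)
    (hP : P u < Finv η v) (hQ : Finv η v < Q u) :
    (v - u) * -((Q u - Finv η u) / (Q u - P u)) ≤ phiFn η γ a b v - phiFn η γ a b u := by
  obtain ⟨hPa, hbQ, -, -, hφ⟩ := hPQ u hu
  have hle := le_phiFn hab hC hPa hbQ hP hQ
  have hpos : 0 < Q u - P u := by linarith
  have hinc := Dfun_Finv_increment hη1 hγ1 hη hγ hu hv
  rw [measureReal_def] at hinc
  refine le_trans ?_ (sub_le_sub_right hle _)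
  rw [hφ, ← sub_div, ← neg_div, ← mul_div_assoc]
  refine div_le_div_of_nonneg_right ?_ hpos.le
  unfold Efun
  linarith

theorem stmt6 (a b : ℝ) (hab : a < b) (η γ : Measure ℝ)
    [IsProbabilityMeasure η] [IsProbabilityMeasure γ]
    (hη1 : Integrable id η) (hγ1 : Integrable id γ)
    (hmean : ∫ x, x ∂η = ∫ x, x ∂γ)
    (hsupη : η (Icc a b)ᶜ = 0) (hsupγ : γ (Ioo a b) = 0)
    (hC : ∀ x : ℝ, Cfun η x ≤ Cfun γ x)
    (P Q : ℝ → ℝ) (hPQ : AttainsSup η γ a b P Q)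
    (hPmono : AntitoneOn P (Ioo 0 1)) (hQmono : AntitoneOn Q (Ioo 0 1)) :
    ∀ᵐ u ∂(volume.restrict (Ioo (0 : ℝ) 1)),
      HasDerivAt (phiFn η γ a b) (-((Q u - Finv η u) / (Q u - P u))) u := by
  have hcount : ∀ {f : ℝ → ℝ}, {x ∈ Ioo (0 : ℝ) 1 | ¬ContinuousWithinAt f (Ioo 0 1) x}.Countable →
      ∀ᵐ u ∂(volume : Measure ℝ), u ∈ Ioo (0 : ℝ) 1 → ContinuousAt f u := by
    intro f hf
    filter_upwards [hf.ae_notMem volume] with u hu hmem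
    by_contra h
    exact hu ⟨hmem, fun hc => h (hc.continuousAt (Ioo_mem_nhds hmem.1 hmem.2))⟩
  rw [ae_restrict_iff' measurableSet_Ioo]
  filter_upwards [hcount hPmono.countable_not_continuousWithinAt,
    hcount hQmono.countable_not_continuousWithinAt,
    hcount (Finv_monotoneOn hsupη).countable_not_continuousWithinAt] with u hPc hQc hFc hu
  specialize hPc hu
  specialize hQc hu
  specialize hFc hu
  obtain ⟨-, -, hPF, hFQ, -⟩ := hPQ u hu
  have hnhds : Ioo (0 : ℝ) 1 ∈ nhds u := Ioo_mem_nhds hu.1 hu.2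
  refine hasDerivAt_of_increment_bounds (c := fun v => -((Q v - Finv η v) / (Q v - P v)))
    ((hQc.sub hFc).div (hQc.sub hPc) (sub_pos.2 (hPF.trans hFQ)).ne').neg ?_ ?_
  · filter_upwards [hnhds, hFc.eventually_const_lt hPF, hFc.eventually_lt_const hFQ] with v hv h1 h2
    exact phiFn_increment hab hη1 hγ1 hsupη hsupγ hC hPQ hu hv h1 h2
  · filter_upwards [hnhds, hPc.eventually_lt_const hPF, hQc.eventually_const_lt hFQ] with v hv h1 h2
    have := phiFn_increment hab hη1 hγ1 hsupη hsupγ hC hPQ hv hu h1 h2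
    linarith
end
end
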